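/- For every pair of integers h, t with 1 ≤ h < t there exist a constant c > 0 and N ∈ ℕ such that for every multiple n of t with n ≥ N, the polyhedron P_{h,t}(n) = {x ∈ ℝ^{E(K_n)} : x(δ(H)) + Σ_{i=1}^{k} x(δ(T_i)) ≥ 3k+1 for every (h,t)-uniform comb with handle H and teeth T_1, …, T_k in K_n} has extension complexity xc(P_{h,t}(n)) ≥ 2^{c·n/t}. -/

import Mathlib

open SimpleGraph Finset

attribute [local instance] Classical.propDecidable

/-- The edge set of the complete graph `K_n`: non-diagonal unordered pairs. -/
abbrev KEdge (n : ℕ) := {e : Sym2 (Fin n) // ¬ e.IsDiag}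

/-- An edge `e` crosses the vertex set `S` if it has an endpoint in `S`
and an endpoint outside `S`. -/
def crossing {V : Type*} (S : Finset V) (e : Sym2 V) : Prop :=
  (∃ a ∈ e, a ∈ S) ∧ (∃ a ∈ e, a ∉ S)

/-- `x(δ(S))`: the sum of the coordinates of `x` over the edges of `K_n`
crossing `S`. -/
noncomputable def cutSum {n : ℕ} (S : Finset (Fin n)) (x : KEdge n → ℝ) : ℝ :=
  ∑ e ∈ Finset.univ.filter (fun e : KEdge n => crossing S e.1), x e

/-- A comb with handle `H` and teeth `T 0, …, T (k-1)`. -/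
def IsComb {V : Type*} [Fintype V] [DecidableEq V]
    (H : Finset V) {k : ℕ} (T : Fin k → Finset V) : Prop :=
  3 ≤ k ∧ Odd k ∧
  (∀ i j, i ≠ j → Disjoint (T i) (T j)) ∧
  (∀ i, (H ∩ T i).Nonempty) ∧
  (H \ Finset.univ.biUnion T).Nonempty

/-- An `(h,t)`-uniform comb: every tooth has size `t` and meets the handle
in exactly `h` vertices. -/
def IsUniformComb {V : Type*} [Fintype V] [DecidableEq V] (h t : ℕ)
    (H : Finset V) {k : ℕ} (T : Fin k → Finset V) : Prop :=
  IsComb H T ∧ ∀ i, (T i).card = t ∧ (H ∩ T i).card = h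

/-- The extension complexity of `P ⊆ ℝ^ι`: the least number of facets
(inequalities) of a polyhedron `{x : Ax ≤ b}` projecting linearly onto `P`. -/
noncomputable def xc {ι : Type*} [Fintype ι] (P : Set (ι → ℝ)) : ℕ :=
  sInf {k | ∃ (m : ℕ) (A : Matrix (Fin k) (Fin m) ℝ) (b : Fin k → ℝ)
      (π : (Fin m → ℝ) →ₗ[ℝ] (ι → ℝ)),
      π '' {x | A.mulVec x ≤ b} = P}


/-- The polyhedron defined by all `(h,t)`-uniform comb inequalities for `TSP_n`. -/
noncomputable def uniformCombPolytope (h t n : ℕ) : Set (KEdge n → ℝ) :=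
  {x | ∀ (H : Finset (Fin n)) (k : ℕ) (T : Fin k → Finset (Fin n)),
      IsUniformComb h t H T → (3 * k + 1 : ℝ) ≤ cutSum H x + ∑ i, cutSum (T i) x}


/-- Kaibel and Weltge: a rectangle avoiding pairs meeting in exactly one element contains at most
`2 ^ m` disjoint pairs. -/
lemma kw_rect {α : Type*} (F : Finset α) : ∀ (P Q : Finset α → Prop),
    (∀ a ⊆ F, ∀ b ⊆ F, P a → Q b → (a ∩ b).card ≠ 1) →
    ∑ a ∈ F.powerset, ∑ b ∈ F.powerset,
      (if Disjoint a b ∧ P a ∧ Q b then 1 else 0 : ℕ) ≤ 2 ^ F.card := by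
  induction F using Finset.induction_on with
  | empty =>
    intro P Q _
    simp only [powerset_empty, sum_singleton, card_empty, pow_zero]
    split_ifs <;> simp
  | insert x F hx ih =>
    intro P Q hPQ
    have h1 := ih (fun a => P a ∨ P (insert x a)) Q (by
      intro a ha b hb hP hQ
      have hxb : x ∉ b := fun h => hx (hb h)
      rcases hP with hP | hP
      · exact hPQ a (ha.trans (subset_insert _ _)) b (hb.trans (subset_insert _ _)) hP hQ
      · have := hPQ _ (insert_subset_insert x ha) b (hb.trans (subset_insert _ _)) hP hQ
        rwa [insert_inter_of_notMem hxb] at this)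
    have h2 := ih P (fun b => Q b ∨ Q (insert x b)) (by
      intro a ha b hb hP hQ
      have hxa : x ∉ a := fun h => hx (ha h)
      rcases hQ with hQ | hQ
      · exact hPQ a (ha.trans (subset_insert _ _)) b (hb.trans (subset_insert _ _)) hP hQ
      · have := hPQ a (ha.trans (subset_insert _ _)) _ (insert_subset_insert x hb) hP hQ
        rwa [inter_insert_of_notMem hxa] at this)
    rw [card_insert_of_notMem hx, pow_succ, mul_two]
    refine le_trans ?_ (Nat.add_le_add h1 h2)
    rw [sum_powerset_insert hx]
    simp_rw [sum_powerset_insert hx]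
    simp_rw [← sum_add_distrib]
    refine sum_le_sum fun a ha => sum_le_sum fun b hb => ?_
    rw [mem_powerset] at ha hb
    have hxa : x ∉ a := fun h => hx (ha h)
    have hxb : x ∉ b := fun h => hx (hb h)
    have e1 : Disjoint a (insert x b) ↔ Disjoint a b := by
      rw [disjoint_insert_right]; tauto
    have e2 : Disjoint (insert x a) b ↔ Disjoint a b := by
      rw [disjoint_insert_left]; tauto
    have e3 : ¬ Disjoint (insert x a) (insert x b) := by
      rw [disjoint_insert_left]; simp
    have e4 : Disjoint a b → ¬ (P (insert x a) ∧ Q (insert x b)) := by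
      rintro hd ⟨hp, hq⟩
      apply hPQ _ (insert_subset_insert x ha) _ (insert_subset_insert x hb) hp hq
      rw [← insert_inter_distrib, disjoint_iff_inter_eq_empty.1 hd]
      simp
    simp only [e1, e2, e3]
    by_cases hd : Disjoint a b
    · have := e4 hd
      clear h1 h2 ih hPQ e1 e2 e3 e4
      generalize P (insert x a) = p1 at *
      generalize Q (insert x b) = q1 at *
      generalize P a = p0 at *
      generalize Q b = q0 at *
      by_cases p0 <;> by_cases p1 <;> by_cases q0 <;> by_cases q1 <;> simp_all
    · simp [hd]

lemma disj_count {α : Type*} (F : Finset α) :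
    ∑ a ∈ F.powerset, ∑ b ∈ F.powerset, (if Disjoint a b then 1 else 0 : ℕ) = 3 ^ F.card := by
  induction F using Finset.induction_on with
  | empty => simp
  | insert x F hx ih =>
    rw [card_insert_of_notMem hx, pow_succ, ← ih, sum_powerset_insert hx]
    simp_rw [sum_powerset_insert hx, sum_mul]
    simp_rw [← sum_add_distrib]
    refine sum_congr rfl fun a ha => sum_congr rfl fun b hb => ?_
    rw [mem_powerset] at ha hb
    have hxa : x ∉ a := fun h => hx (ha h)
    have hxb : x ∉ b := fun h => hx (hb h)
    have e1 : Disjoint a (insert x b) ↔ Disjoint a b := by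
      rw [disjoint_insert_right]; tauto
    have e2 : Disjoint (insert x a) b ↔ Disjoint a b := by
      rw [disjoint_insert_left]; tauto
    have e3 : ¬ Disjoint (insert x a) (insert x b) := by
      rw [disjoint_insert_left]; simp
    simp only [e1, e2, e3]
    by_cases hd : Disjoint a b <;> simp [hd]

/-- Rectangle covering bound for unique disjointness. -/
lemma rect_cover {α : Type*} (F : Finset α) (k : ℕ) (P Q : Fin k → Finset α → Prop)
    (h1 : ∀ i, ∀ a ⊆ F, ∀ b ⊆ F, P i a → Q i b → (a ∩ b).card ≠ 1)
    (h2 : ∀ a ⊆ F, ∀ b ⊆ F, a.Nonempty → Disjoint a b → ∃ i, P i a ∧ Q i b) :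
    3 ^ F.card ≤ (k + 1) * 2 ^ F.card := by
  rw [← disj_count F]
  have hA : ∑ i : Fin k, ∑ a ∈ F.powerset, ∑ b ∈ F.powerset,
      (if Disjoint a b ∧ P i a ∧ Q i b then 1 else 0 : ℕ) ≤ k * 2 ^ F.card := by
    refine (sum_le_sum fun i _ => kw_rect F (P i) (Q i) (h1 i)).trans ?_
    simp
  have hB := kw_rect F (fun a => a = ∅) (fun _ => True) (by rintro a - b - rfl -; simp)
  rw [add_mul, one_mul]
  refine le_trans ?_ (Nat.add_le_add hA hB)
  rw [sum_comm (s := (univ : Finset (Fin k))), ← sum_add_distrib]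
  refine sum_le_sum fun a ha => ?_
  rw [sum_comm (s := (univ : Finset (Fin k))), ← sum_add_distrib]
  refine sum_le_sum fun b hb => ?_
  rw [mem_powerset] at ha hb
  by_cases hd : Disjoint a b
  · rcases a.eq_empty_or_nonempty with rfl | hne
    · simp
    · obtain ⟨i, hi⟩ := h2 a ha b hb hne hd
      rw [if_pos hd]
      refine le_trans ?_ (Nat.le_add_right _ _)
      refine le_trans ?_ (single_le_sum (fun _ _ => Nat.zero_le _) (mem_univ i))
      simp [hd, hi]
  · simp [hd]

/-- Lower bound on the size of any extension, via unique disjointness. -/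
lemma ext_bound {ι α : Type*} (F : Finset α) (P : Set (ι → ℝ))
    (g : Finset α → (ι → ℝ) →ₗ[ℝ] ℝ) (d : ℝ) (p : Finset α → ι → ℝ)
    (hv : ∀ a ⊆ F, ∀ x ∈ P, d ≤ g a x) (hp : ∀ b ⊆ F, p b ∈ P)
    (hs : ∀ a ⊆ F, ∀ b ⊆ F, g a (p b) = d + (1 - ((a ∩ b).card : ℝ)) ^ 2)
    (k m : ℕ) (A : Matrix (Fin k) (Fin m) ℝ) (c : Fin k → ℝ)
    (π : (Fin m → ℝ) →ₗ[ℝ] (ι → ℝ)) (hπ : π '' {x | A.mulVec x ≤ c} = P) :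
    3 ^ F.card ≤ (k + 1) * 2 ^ F.card := by
  have hy : ∀ b, ∃ y, b ⊆ F → (A.mulVec y ≤ c ∧ π y = p b) := by
    intro b
    by_cases hb : b ⊆ F
    · have := hp b hb
      rw [← hπ] at this
      obtain ⟨y, hy, hy'⟩ := this
      exact ⟨y, fun _ => ⟨hy, hy'⟩⟩
    · exact ⟨0, fun h => absurd h hb⟩
  choose y hy using hy
  refine rect_cover F k
    (fun i a => ∀ b ⊆ F, (a ∩ b).card = 1 → A.mulVec (y b) i = c i)
    (fun i b => A.mulVec (y b) i < c i) ?_ ?_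
  · intro i a _ b hb hP hQ h1
    exact absurd (hP b hb h1) hQ.ne
  · intro a ha b hb hne hd
    by_contra hcon
    push Not at hcon
    set B := F.powerset.filter (fun b' => (a ∩ b').card = 1) with hB
    have hBm : ∀ b', b' ∈ B ↔ b' ⊆ F ∧ (a ∩ b').card = 1 := by
      intro b'; simp [hB]
    have hBne : B.Nonempty := by
      obtain ⟨v, hv⟩ := hne
      refine ⟨{v}, (hBm _).2 ⟨by simpa using ha hv, ?_⟩⟩
      rw [inter_singleton_of_mem hv]; simp
    have hN : (0 : ℝ) < B.card := by exact_mod_cast hBne.card_pos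
    -- direction
    set s := ∑ b' ∈ B, (y b' - y b) with hsdef
    have key : ∃ ε : ℝ, 0 < ε ∧ ∀ i, ∑ b' ∈ B, A.mulVec (y b') i
        + ε * ∑ b' ∈ B, (A.mulVec (y b') i - A.mulVec (y b) i) ≤ B.card * c i := by
      have each : ∀ i, ∃ ε : ℝ, 0 < ε ∧ ∀ δ, 0 < δ → δ ≤ ε → ∑ b' ∈ B, A.mulVec (y b') i
        + δ * ∑ b' ∈ B, (A.mulVec (y b') i - A.mulVec (y b) i) ≤ B.card * c i := by
        intro i
        have hle : ∀ b' ∈ B, A.mulVec (y b') i ≤ c i := fun b' hb' =>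
          (hy b' ((hBm _).1 hb').1).1 i
        have hsum : ∑ b' ∈ B, A.mulVec (y b') i ≤ B.card * c i := by
          have := sum_le_sum hle
          simpa using this
        by_cases hT : ∀ b' ⊆ F, (a ∩ b').card = 1 → A.mulVec (y b') i = c i
        · refine ⟨1, one_pos, fun δ hδ _ => ?_⟩
          have e1 := hcon i hT
          have e2 : ∑ b' ∈ B, (A.mulVec (y b') i - A.mulVec (y b) i) ≤ 0 := by
            refine sum_nonpos fun b' hb' => ?_
            linarith [hle b' hb']
          nlinarith
        · push Not at hT
          obtain ⟨b0, hb0, hb1, hb2⟩ := hT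
          have hlt : ∑ b' ∈ B, A.mulVec (y b') i < B.card * c i := by
            have := sum_lt_sum hle ⟨b0, (hBm _).2 ⟨hb0, hb1⟩,
              lt_of_le_of_ne (hle _ ((hBm _).2 ⟨hb0, hb1⟩)) hb2⟩
            simpa using this
          set D := ∑ b' ∈ B, (A.mulVec (y b') i - A.mulVec (y b) i)
          set G := B.card * c i - ∑ b' ∈ B, A.mulVec (y b') i with hG
          have hGpos : 0 < G := by rw [hG]; linarith
          refine ⟨G / (|D| + 1), by positivity, fun δ hδ hδ' => ?_⟩
          have : δ * (|D| + 1) ≤ G := (le_div_iff₀ (by positivity)).1 hδ'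
          have h3 : δ * D ≤ δ * |D| := mul_le_mul_of_nonneg_left (le_abs_self D) hδ.le
          have : δ * D ≤ G := by nlinarith
          linarith
      choose ε hε hε' using each
      rcases Nat.eq_zero_or_pos k with hk | hk
      · subst hk
        exact ⟨1, one_pos, fun i => i.elim0⟩
      · have : (univ : Finset (Fin k)).Nonempty := ⟨⟨0, hk⟩, mem_univ _⟩
        refine ⟨univ.inf' this ε, ?_, fun i => hε' i _ ?_ ?_⟩
        · rw [lt_inf'_iff]; exact fun i _ => hε i
        · rw [lt_inf'_iff]; exact fun i _ => hε i
        · exact inf'_le _ (mem_univ i)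
    obtain ⟨ε, hε, hle⟩ := key
    set z : Fin m → ℝ := (B.card : ℝ)⁻¹ • (∑ b' ∈ B, y b' + ε • s) with hz
    have hzmem : π z ∈ P := by
      rw [← hπ]
      refine ⟨z, ?_, rfl⟩
      intro i
      have : A.mulVec z i = (B.card : ℝ)⁻¹ * (∑ b' ∈ B, A.mulVec (y b') i
        + ε * ∑ b' ∈ B, (A.mulVec (y b') i - A.mulVec (y b) i)) := by
        have e : A.mulVec z = (B.card : ℝ)⁻¹ • (∑ b' ∈ B, A.mulVec (y b') +
            ε • ∑ b' ∈ B, (A.mulVec (y b') - A.mulVec (y b))) := by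
          have e' : ∀ w, A.mulVec w = A.mulVecLin w := fun w => rfl
          simp only [e', hz, hsdef, map_smul, map_add, map_sum, map_sub]
        rw [e]
        simp [Finset.sum_apply]
      rw [this, inv_mul_le_iff₀ hN]
      exact hle i
    have h1 := hv a ha _ hzmem
    have h2 : g a (π z) = (B.card : ℝ)⁻¹ * (∑ b' ∈ B, g a (p b')
        + ε * ∑ b' ∈ B, (g a (p b') - g a (p b))) := by
      have e3 : ∀ b' ∈ B, g a (p b') = g a (π (y b')) := fun b' hb' => by
        rw [(hy b' ((hBm _).1 hb').1).2]
      rw [sum_sub_distrib, sum_congr rfl e3, ← (hy b hb).2]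
      simp only [hz, hsdef, map_smul, map_add, map_sum, map_sub, smul_eq_mul, sum_sub_distrib]
    have e4 : ∀ b' ∈ B, g a (p b') = d := by
      intro b' hb'
      obtain ⟨q1, q2⟩ := (hBm _).1 hb'
      rw [hs a ha b' q1, q2]; simp
    have e5 : g a (p b) = d + 1 := by
      rw [hs a ha b hb, disjoint_iff_inter_eq_empty.1 hd]; simp
    rw [h2, sum_sub_distrib, sum_congr rfl e4, e5] at h1
    simp only [sum_const, nsmul_eq_mul] at h1
    rw [le_inv_mul_iff₀ hN] at h1
    nlinarith

/-- Unit vector of the edge `ab` (zero if `a = b`). -/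
noncomputable def ev {n : ℕ} (a b : Fin n) : KEdge n → ℝ :=
  fun e => if e.1 = s(a, b) then 1 else 0

/-- Whether `S` separates `a` from `b`. -/
noncomputable def chi {n : ℕ} (S : Finset (Fin n)) (a b : Fin n) : ℝ :=
  if (a ∈ S ↔ b ∈ S) then 0 else 1

/-- `cutSum` as a linear map. -/
noncomputable def cutL {n : ℕ} (S : Finset (Fin n)) : (KEdge n → ℝ) →ₗ[ℝ] ℝ where
  toFun := cutSum S
  map_add' x y := by simp [cutSum, sum_add_distrib]
  map_smul' r x := by simp [cutSum, mul_sum]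

lemma cutL_apply {n : ℕ} (S : Finset (Fin n)) (x : KEdge n → ℝ) : cutL S x = cutSum S x := rfl

lemma crossing_mk {n : ℕ} (S : Finset (Fin n)) (a b : Fin n) :
    crossing S s(a, b) ↔ ¬ (a ∈ S ↔ b ∈ S) := by
  simp only [crossing, Sym2.mem_iff]
  constructor
  · rintro ⟨⟨x, rfl | rfl, hx⟩, ⟨y, rfl | rfl, hy⟩⟩ <;> tauto
  · intro h
    by_cases ha : a ∈ S
    · exact ⟨⟨a, Or.inl rfl, ha⟩, ⟨b, Or.inr rfl, by tauto⟩⟩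
    · exact ⟨⟨b, Or.inr rfl, by tauto⟩, ⟨a, Or.inl rfl, ha⟩⟩

lemma cutL_ev {n : ℕ} (S : Finset (Fin n)) (a b : Fin n) : cutL S (ev a b) = chi S a b := by
  rw [cutL_apply, cutSum, chi]
  split_ifs with h
  · refine sum_eq_zero fun e he => ?_
    rw [mem_filter] at he
    rw [ev, if_neg]
    intro heq
    rw [heq, crossing_mk] at he
    exact he.2 h
  · have hab : a ≠ b := by rintro rfl; exact h Iff.rfl
    rw [sum_eq_single (⟨s(a, b), by simpa using hab⟩ : KEdge n)]
    · simp [ev]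
    · intro e _ hne
      rw [ev, if_neg]
      intro heq
      exact hne (Subtype.ext heq)
    · intro hn
      refine absurd ?_ hn
      rw [mem_filter]
      exact ⟨mem_univ _, (crossing_mk S a b).2 h⟩

lemma cutSum_ge {n : ℕ} (x : KEdge n → ℝ) (S : Finset (Fin n)) : -∑ e, |x e| ≤ cutSum S x := by
  have h1 : |cutSum S x| ≤ ∑ e, |x e| :=
    (abs_sum_le_sum_abs _ _).trans
      (sum_le_sum_of_subset_of_nonneg (filter_subset _ _) fun _ _ _ => abs_nonneg _)
  linarith [neg_abs_le (cutSum S x)]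

lemma chi_nonneg {n : ℕ} (S : Finset (Fin n)) (a b : Fin n) : 0 ≤ chi S a b := by
  unfold chi; split_ifs <;> norm_num

lemma sum_chi_in {n : ℕ} (S X : Finset (Fin n)) (r : Fin n) (hr : r ∈ S) :
    ∑ v ∈ X, chi S r v = ((X \ S).card : ℝ) := by
  simp only [chi, hr, true_iff]
  rw [sum_ite, sum_const_zero, zero_add, sum_const, nsmul_one]
  congr 2; ext; simp

lemma sum_chi_out {n : ℕ} (S X : Finset (Fin n)) (r : Fin n) (hr : r ∉ S) :
    ∑ v ∈ X, chi S r v = ((X ∩ S).card : ℝ) := by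
  simp only [chi, hr, false_iff]
  rw [sum_ite, sum_const_zero, zero_add, sum_const, nsmul_one]
  congr 2; ext; simp

lemma sum_chi_sep {n : ℕ} (S X : Finset (Fin n)) (r q : Fin n) (h : ¬ (r ∈ S ↔ q ∈ S)) :
    ∑ v ∈ X, chi S r v + ∑ v ∈ X, chi S q v = (X.card : ℝ) := by
  have := card_inter_add_card_sdiff X S
  have h' : ((X ∩ S).card : ℝ) + (X \ S).card = X.card := by exact_mod_cast this
  by_cases hr : r ∈ S
  · have hq : q ∉ S := by tauto
    rw [sum_chi_in _ _ _ hr, sum_chi_out _ _ _ hq]; linarith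
  · have hq : q ∈ S := by tauto
    rw [sum_chi_in _ _ _ hq, sum_chi_out _ _ _ hr]; linarith

lemma sum_chi_pair {n : ℕ} (S X : Finset (Fin n)) (q : Fin n) :
    ∑ v ∈ X, ∑ w ∈ X, chi S v w
      = 2 * (∑ v ∈ X, chi S q v) * (X.card - ∑ v ∈ X, chi S q v) := by
  have := card_inter_add_card_sdiff X S
  have h' : ((X ∩ S).card : ℝ) + (X \ S).card = X.card := by exact_mod_cast this
  have h1 : ∑ v ∈ X, ∑ w ∈ X, chi S v w = 2 * ((X ∩ S).card : ℝ) * (X \ S).card := by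
    have : ∀ v ∈ X, ∑ w ∈ X, chi S v w =
        if v ∈ S then ((X \ S).card : ℝ) else ((X ∩ S).card : ℝ) := by
      intro v _
      split_ifs with hv
      · exact sum_chi_in _ _ _ hv
      · exact sum_chi_out _ _ _ hv
    rw [sum_congr rfl this, sum_ite, sum_const, sum_const, nsmul_eq_mul, nsmul_eq_mul,
      filter_mem_eq_inter, filter_notMem_eq_sdiff]
    ring
  rw [h1]
  by_cases hq : q ∈ S
  · rw [sum_chi_in _ _ _ hq, ← h']; ring
  · rw [sum_chi_out _ _ _ hq, ← h']; ring

/-- The fixed configuration of vertices used to embed unique disjointness. -/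
structure Cfg (n h t : ℕ) where
  r : Fin n
  q : Fin n
  R : Finset (Fin n)
  Q : Finset (Fin n)
  W : Finset (Fin n)
  F : Finset (Fin n)
  T : Fin 3 → Finset (Fin n)
  A : Fin 3 → Finset (Fin n)
  rq : r ≠ q
  rR : r ∉ R
  rQ : r ∉ Q
  rW : r ∉ W
  rF : r ∉ F
  qR : q ∉ R
  qQ : q ∉ Q
  qW : q ∉ W
  qF : q ∉ F
  RQ : Disjoint R Q
  RW : Disjoint R W
  RF : Disjoint R F
  QW : Disjoint Q W
  QF : Disjoint Q F
  WF : Disjoint W F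
  cover : ∀ v, v = r ∨ v = q ∨ v ∈ R ∨ v ∈ Q ∨ v ∈ W ∨ v ∈ F
  cR : R.card = t
  cQ : Q.card = t
  cW : W.card = 3 * t
  TW : ∀ i, T i ⊆ W
  TT : ∀ i j, i ≠ j → Disjoint (T i) (T j)
  cT : ∀ i, (T i).card = t
  AT : ∀ i, A i ⊆ T i
  cA : ∀ i, (A i).card = h

namespace Cfg

variable {n h t : ℕ} (C : Cfg n h t)

/-- The direction selecting the good combs. -/
noncomputable def u : KEdge n → ℝ :=
  (8 * t + 4 : ℝ) • ∑ v ∈ C.R, ev C.r v + (8 * t + 4 : ℝ) • ∑ v ∈ C.Q, ev C.q v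
  + (∑ v ∈ C.W, ev C.r v + ∑ v ∈ C.W, ev C.q v)
  + (2 : ℝ) • (∑ v ∈ C.F, ev C.r v + ∑ v ∈ C.F, ev C.q v)
  - (9 * t + 2 * C.F.card : ℝ) • ev C.r C.q

/-- The vector encoding the set `b`. -/
noncomputable def w (b : Finset (Fin n)) : KEdge n → ℝ :=
  (11 : ℝ) • ev C.r C.q + (b.card - 2 : ℝ) • ∑ v ∈ b, ev C.q v
  - (1 / 2 : ℝ) • ∑ v ∈ b, ∑ v' ∈ b, ev v v'

lemma cut_u (S : Finset (Fin n)) : cutL S C.u =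
    (8 * t + 4 : ℝ) * ∑ v ∈ C.R, chi S C.r v + (8 * t + 4 : ℝ) * ∑ v ∈ C.Q, chi S C.q v
  + (∑ v ∈ C.W, chi S C.r v + ∑ v ∈ C.W, chi S C.q v)
  + 2 * (∑ v ∈ C.F, chi S C.r v + ∑ v ∈ C.F, chi S C.q v)
  - (9 * t + 2 * C.F.card : ℝ) * chi S C.r C.q := by
  simp only [u, map_add, map_sub, map_smul, map_sum, cutL_ev, smul_eq_mul]

lemma cut_w (b S : Finset (Fin n)) : cutL S (C.w b) =
    11 * chi S C.r C.q + (b.card - 2 : ℝ) * ∑ v ∈ b, chi S C.q v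
  - 1 / 2 * ∑ v ∈ b, ∑ v' ∈ b, chi S v v' := by
  simp only [w, map_add, map_sub, map_smul, map_sum, cutL_ev, smul_eq_mul]

lemma cut_u_sep (S : Finset (Fin n)) (hS : ¬ (C.r ∈ S ↔ C.q ∈ S)) : cutL S C.u =
    (8 * t + 4 : ℝ) * ∑ v ∈ C.R, chi S C.r v + (8 * t + 4 : ℝ) * ∑ v ∈ C.Q, chi S C.q v
    - 6 * t := by
  have h1 := sum_chi_sep S C.W _ _ hS
  have h2 := sum_chi_sep S C.F _ _ hS
  have h3 : chi S C.r C.q = 1 := by rw [chi, if_neg hS]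
  rw [cut_u, h1, h2, h3, C.cW]
  push_cast; ring

lemma sum_nn (S X : Finset (Fin n)) (r : Fin n) : 0 ≤ ∑ v ∈ X, chi S r v :=
  sum_nonneg fun _ _ => chi_nonneg _ _ _

lemma cut_u_nonsep (S : Finset (Fin n)) (hS : (C.r ∈ S ↔ C.q ∈ S)) : cutL S C.u =
    (8 * t + 4 : ℝ) * ∑ v ∈ C.R, chi S C.r v + (8 * t + 4 : ℝ) * ∑ v ∈ C.Q, chi S C.q v
  + (∑ v ∈ C.W, chi S C.r v + ∑ v ∈ C.W, chi S C.q v)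
  + 2 * (∑ v ∈ C.F, chi S C.r v + ∑ v ∈ C.F, chi S C.q v) := by
  have h3 : chi S C.r C.q = 0 := by rw [chi, if_pos hS]
  rw [cut_u, h3]; ring

lemma cut_u_sep_ge (S : Finset (Fin n)) (hS : ¬ (C.r ∈ S ↔ C.q ∈ S)) :
    -(6 * t : ℝ) ≤ cutL S C.u := by
  rw [cut_u_sep _ _ hS]
  have h1 := sum_nn S C.R C.r
  have h2 := sum_nn S C.Q C.q
  have : (0 : ℝ) ≤ (8 * t + 4 : ℝ) * ∑ v ∈ C.R, chi S C.r v := by positivity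
  have : (0 : ℝ) ≤ (8 * t + 4 : ℝ) * ∑ v ∈ C.Q, chi S C.q v := by positivity
  linarith

lemma cut_u_nonsep_ge (S : Finset (Fin n)) (hS : (C.r ∈ S ↔ C.q ∈ S)) :
    0 ≤ cutL S C.u := by
  rw [cut_u_nonsep _ _ hS]
  have h1 := sum_nn S C.R C.r
  have h2 := sum_nn S C.Q C.q
  have h3 := sum_nn S C.W C.r
  have h4 := sum_nn S C.W C.q
  have h5 := sum_nn S C.F C.r
  have h6 := sum_nn S C.F C.q
  positivity

lemma card_sdiff_pos_of {X S : Finset (Fin n)} {r : Fin n} (hr : r ∈ S) (hrX : r ∉ X)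
    (hc : S.card ≤ X.card) : (1 : ℝ) ≤ ((X \ S).card : ℝ) := by
  have : (X \ S).Nonempty := by
    rw [sdiff_nonempty]
    intro hsub
    have := card_lt_card (Finset.ssubset_iff_subset_ne.2 ⟨hsub, fun h => hrX (h ▸ hr)⟩)
    omega
  exact_mod_cast this.card_pos

/-- Every tooth costs at least `2t`, and more unless it lies in `W`. -/
lemma tooth (S : Finset (Fin n)) (hS : S.card = t) :
    (S ⊆ C.W ∧ cutL S C.u = 2 * t) ∨ (2 * t + 1 : ℝ) ≤ cutL S C.u := by
  have n1 := sum_nn S C.R C.r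
  have n2 := sum_nn S C.Q C.q
  have n3 := sum_nn S C.W C.r
  have n4 := sum_nn S C.W C.q
  have n5 := sum_nn S C.F C.r
  have n6 := sum_nn S C.F C.q
  have ht : (0 : ℝ) ≤ t := Nat.cast_nonneg _
  by_cases hr : C.r ∈ S
  · right
    have h1 : 1 ≤ ∑ v ∈ C.R, chi S C.r v := by
      rw [sum_chi_in _ _ _ hr]
      exact card_sdiff_pos_of hr C.rR (by rw [hS, C.cR])
    by_cases hq : C.q ∈ S
    · rw [cut_u_nonsep _ _ (by tauto)]; nlinarith
    · rw [cut_u_sep _ _ (by tauto)]; nlinarith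
  · by_cases hq : C.q ∈ S
    · right
      have h1 : 1 ≤ ∑ v ∈ C.Q, chi S C.q v := by
        rw [sum_chi_in _ _ _ hq]
        exact card_sdiff_pos_of hq C.qQ (by rw [hS, C.cQ])
      rw [cut_u_sep _ _ (by tauto)]; nlinarith
    · have hS' : S = (C.R ∩ S) ∪ ((C.Q ∩ S) ∪ ((C.W ∩ S) ∪ (C.F ∩ S))) := by
        ext v
        simp only [mem_union, mem_inter]
        constructor
        · intro hv
          rcases C.cover v with rfl | rfl | h | h | h | h <;> tauto
        · tauto
      have hcard : S.card = (C.R ∩ S).card + ((C.Q ∩ S).card + ((C.W ∩ S).card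
          + (C.F ∩ S).card)) := by
        have dd : ∀ {X Y : Finset (Fin n)}, Disjoint X Y → Disjoint (X ∩ S) (Y ∩ S) :=
          fun hXY => hXY.mono inter_subset_left inter_subset_left
        conv_lhs => rw [hS']
        rw [card_union_of_disjoint, card_union_of_disjoint, card_union_of_disjoint]
        · exact dd C.WF
        · rw [disjoint_union_right]; exact ⟨dd C.QW, dd C.QF⟩
        · rw [disjoint_union_right, disjoint_union_right]
          exact ⟨dd C.RQ, dd C.RW, dd C.RF⟩
      have hcard' : (t : ℝ) = (C.R ∩ S).card + ((C.Q ∩ S).card + ((C.W ∩ S).card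
          + (C.F ∩ S).card)) := by
        have hc3 := hS.symm.trans hcard
        exact_mod_cast hc3
      rw [cut_u_nonsep _ _ (by tauto), sum_chi_out _ _ _ hr, sum_chi_out _ _ _ hr,
        sum_chi_out _ _ _ hr, sum_chi_out _ _ _ hq, sum_chi_out _ _ _ hq, sum_chi_out _ _ _ hq]
      by_cases hz : (C.R ∩ S).card + (C.Q ∩ S).card + (C.F ∩ S).card = 0
      · left
        have z1 : (C.R ∩ S).card = 0 := by omega
        have z2 : (C.Q ∩ S).card = 0 := by omega
        have z3 : (C.F ∩ S).card = 0 := by omega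
        constructor
        · rw [hS', card_eq_zero.1 z1, card_eq_zero.1 z2, card_eq_zero.1 z3]
          simp
        · rw [z1, z2, z3] at hcard' ⊢
          push_cast at hcard' ⊢
          nlinarith
      · right
        have hz' : (1 : ℝ) ≤ (C.R ∩ S).card + (C.Q ∩ S).card + (C.F ∩ S).card := by
          exact_mod_cast Nat.one_le_iff_ne_zero.2 hz
        have m1 : (0 : ℝ) ≤ (C.R ∩ S).card := Nat.cast_nonneg _
        have m2 : (0 : ℝ) ≤ (C.Q ∩ S).card := Nat.cast_nonneg _
        have m3 : (0 : ℝ) ≤ (C.F ∩ S).card := Nat.cast_nonneg _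
        nlinarith [mul_nonneg ht m1, mul_nonneg ht m2]

lemma cut_w_sep (b S : Finset (Fin n)) (hS : ¬ (C.r ∈ S ↔ C.q ∈ S)) :
    cutL S (C.w b) = 10 + (1 - ∑ v ∈ b, chi S C.q v) ^ 2 := by
  have h3 : chi S C.r C.q = 1 := by rw [chi, if_neg hS]
  rw [cut_w, h3, sum_chi_pair S b C.q]
  ring

lemma cut_w_zero (b S : Finset (Fin n)) (hb : b ⊆ C.F) (hS : S ⊆ C.W) :
    cutL S (C.w b) = 0 := by
  have hr : C.r ∉ S := fun h => C.rW (hS h)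
  have hq : C.q ∉ S := fun h => C.qW (hS h)
  have hv : ∀ v ∈ b, v ∉ S := fun v hv h => (Finset.disjoint_left.1 C.WF (hS h)) (hb hv)
  have h0 : b ∩ S = ∅ := by
    rw [← disjoint_iff_inter_eq_empty, Finset.disjoint_left]; exact hv
  have h3 : chi S C.r C.q = 0 := by simp [chi, hr, hq]
  rw [cut_w, h3, sum_chi_pair S b C.q, sum_chi_out _ _ _ hq, h0]
  simp

/-- The big multiplier. -/
noncomputable def L (b : Finset (Fin n)) : ℝ := (n + 1) * ∑ e, |C.w b e| + 3 * n + 1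

/-- The point of the polyhedron encoding `b`. -/
noncomputable def p (b : Finset (Fin n)) : KEdge n → ℝ := C.L b • C.u + C.w b

lemma teeth_le {k : ℕ} (ht : 1 ≤ t) {T : Fin k → Finset (Fin n)}
    (hd : ∀ i j, i ≠ j → Disjoint (T i) (T j)) (hc : ∀ i, (T i).card = t) : k ≤ n := by
  have h1 : (univ.biUnion T).card = ∑ i, (T i).card :=
    card_biUnion fun i _ j _ hij => hd i j hij
  have h2 : (univ.biUnion T).card ≤ n := by
    simpa using card_le_univ (univ.biUnion T)
  simp only [hc, sum_const, card_univ, Fintype.card_fin, smul_eq_mul] at h1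
  nlinarith

lemma p_mem (ht : 1 ≤ t) (b : Finset (Fin n)) (hb : b ⊆ C.F) :
    C.p b ∈ uniformCombPolytope h t n := by
  intro H k T hT
  obtain ⟨⟨hk3, -, hd, -, -⟩, hc⟩ := hT
  have hkn : k ≤ n := teeth_le ht hd fun i => (hc i).1
  have hkn' : (k : ℝ) ≤ n := by exact_mod_cast hkn
  have hk3' : (3 : ℝ) ≤ k := by exact_mod_cast hk3
  have ht' : (1 : ℝ) ≤ t := by exact_mod_cast ht
  simp only [← cutL_apply]
  have hlin : cutL H (C.p b) + ∑ i, cutL (T i) (C.p b) =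
      C.L b * (cutL H C.u + ∑ i, cutL (T i) C.u) + (cutL H (C.w b) + ∑ i, cutL (T i) (C.w b)) := by
    simp only [p, map_add, map_smul, smul_eq_mul, sum_add_distrib, ← mul_sum]
    ring
  rw [hlin]
  have htooth : ∀ i, (2 * t : ℝ) ≤ cutL (T i) C.u := fun i => by
    rcases C.tooth (T i) (hc i).1 with h | h
    · exact h.2.ge
    · linarith
  have hsum : k * (2 * t : ℝ) ≤ ∑ i, cutL (T i) C.u := by
    have := sum_le_sum (s := univ) fun i _ => htooth i
    simpa using this
  have hL0 : 0 ≤ ∑ e, |C.w b e| := sum_nonneg fun _ _ => abs_nonneg _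
  -- the generic case
  have generic : 1 ≤ cutL H C.u + ∑ i, cutL (T i) C.u → (3 * k + 1 : ℝ) ≤
      C.L b * (cutL H C.u + ∑ i, cutL (T i) C.u)
        + (cutL H (C.w b) + ∑ i, cutL (T i) (C.w b)) := by
    intro h1
    have hL : 0 ≤ C.L b := by unfold L; positivity
    have e1 : C.L b ≤ C.L b * (cutL H C.u + ∑ i, cutL (T i) C.u) := le_mul_of_one_le_right hL h1
    have e2 : -∑ e, |C.w b e| ≤ cutL H (C.w b) := cutSum_ge _ _
    have e3 : k * (-∑ e, |C.w b e|) ≤ ∑ i, cutL (T i) (C.w b) := by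
      have := sum_le_sum (s := univ) fun i (_ : i ∈ univ) => cutSum_ge (C.w b) (T i)
      simpa [cutL_apply] using this
    have e4 : C.L b = (n + 1) * ∑ e, |C.w b e| + 3 * n + 1 := rfl
    nlinarith
  by_cases hsep : C.r ∈ H ↔ C.q ∈ H
  · apply generic
    have := C.cut_u_nonsep_ge H hsep
    nlinarith
  have hH := C.cut_u_sep_ge H hsep
  by_cases hk4 : 4 ≤ k
  · apply generic
    have hk4' : (4 : ℝ) ≤ k := by exact_mod_cast hk4
    nlinarith
  have hk : k = 3 := by omega
  subst hk
  by_cases hW : ∀ i, T i ⊆ C.W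
  · have hz : ∑ i, cutL (T i) (C.w b) = 0 := sum_eq_zero fun i _ => C.cut_w_zero b _ hb (hW i)
    rw [hz, C.cut_w_sep b H hsep]
    have hL : 0 ≤ C.L b := by unfold L; positivity
    have : 0 ≤ C.L b * (cutL H C.u + ∑ i, cutL (T i) C.u) := by
      apply mul_nonneg hL
      push_cast at hsum
      linarith
    push_cast
    nlinarith [sq_nonneg (1 - ∑ v ∈ b, chi H C.q v)]
  · push Not at hW
    obtain ⟨i, hi⟩ := hW
    apply generic
    have h1 : (2 * t + 1 : ℝ) ≤ cutL (T i) C.u := by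
      rcases C.tooth (T i) (hc i).1 with h | h
      · exact absurd h.1 hi
      · exact h
    have h2 : (3 : ℕ) * (2 * t : ℝ) + 1 ≤ ∑ i, cutL (T i) C.u := by
      have e := add_sum_erase univ (fun i => cutL (T i) C.u) (mem_univ i)
      have e' := sum_le_sum (s := univ.erase i) fun i _ => htooth i
      simp only [sum_const, card_erase_of_mem (mem_univ i), card_univ, Fintype.card_fin,
        nsmul_eq_mul] at e'
      push_cast at e' ⊢
      linarith
    push_cast at h2
    linarith

/-- The handle encoding `a`. -/
noncomputable def H (a : Finset (Fin n)) : Finset (Fin n) :=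
  insert C.r (C.R ∪ (a ∪ univ.biUnion C.A))

lemma A_sub_W (i : Fin 3) : C.A i ⊆ C.W := (C.AT i).trans (C.TW i)

lemma mem_H (a : Finset (Fin n)) (v : Fin n) :
    v ∈ C.H a ↔ v = C.r ∨ v ∈ C.R ∨ v ∈ a ∨ ∃ i, v ∈ C.A i := by
  simp [H]

lemma H_inter_T (a : Finset (Fin n)) (ha : a ⊆ C.F) (i : Fin 3) : C.H a ∩ C.T i = C.A i := by
  ext v
  rw [mem_inter, mem_H]
  constructor
  · rintro ⟨rfl | h | h | ⟨j, h⟩, hv⟩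
    · exact absurd (C.TW i hv) C.rW
    · exact absurd (C.TW i hv) (Finset.disjoint_left.1 C.RW h)
    · exact absurd (ha h) (Finset.disjoint_left.1 C.WF (C.TW i hv))
    · by_cases hij : j = i
      · exact hij ▸ h
      · exact absurd hv (Finset.disjoint_left.1 (C.TT j i hij) (C.AT j h))
  · intro h
    exact ⟨Or.inr (Or.inr (Or.inr ⟨i, h⟩)), C.AT i h⟩

lemma H_comb (hh : 1 ≤ h) (a : Finset (Fin n)) (ha : a ⊆ C.F) :
    IsUniformComb h t (C.H a) C.T := by
  refine ⟨⟨le_rfl, by decide, C.TT, ?_, ⟨C.r, ?_⟩⟩, ?_⟩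
  · intro i
    rw [C.H_inter_T a ha i, ← card_pos, C.cA]
    exact hh
  · rw [mem_sdiff, mem_H]
    refine ⟨Or.inl rfl, ?_⟩
    simp only [mem_biUnion, mem_univ, true_and, not_exists]
    exact fun i hi => C.rW (C.TW i hi)
  · intro i
    rw [C.H_inter_T a ha i]
    exact ⟨C.cT i, C.cA i⟩

/-- The comb functional. -/
noncomputable def g (a : Finset (Fin n)) : (KEdge n → ℝ) →ₗ[ℝ] ℝ :=
  cutL (C.H a) + ∑ i, cutL (C.T i)

lemma slack (a b : Finset (Fin n)) (ha : a ⊆ C.F) (hb : b ⊆ C.F) :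
    C.g a (C.p b) = 10 + (1 - ((a ∩ b).card : ℝ)) ^ 2 := by
  have hr : C.r ∈ C.H a := (C.mem_H _ _).2 (Or.inl rfl)
  have hq : C.q ∉ C.H a := by
    rw [mem_H]
    rintro (h | h | h | ⟨j, h⟩)
    · exact C.rq h.symm
    · exact C.qR h
    · exact C.qF (ha h)
    · exact C.qW (C.A_sub_W j h)
  have hsep : ¬ (C.r ∈ C.H a ↔ C.q ∈ C.H a) := by tauto
  have e1 : cutL (C.H a) C.u = - 6 * t := by
    have z1 : C.R \ C.H a = ∅ := by
      rw [sdiff_eq_empty_iff_subset]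
      intro v hv
      exact (C.mem_H _ _).2 (Or.inr (Or.inl hv))
    have z2 : C.Q ∩ C.H a = ∅ := by
      rw [← disjoint_iff_inter_eq_empty, Finset.disjoint_left]
      intro v hv
      rw [mem_H]
      rintro (rfl | h | h | ⟨j, h⟩)
      · exact C.rQ hv
      · exact Finset.disjoint_left.1 C.RQ h hv
      · exact Finset.disjoint_left.1 C.QF hv (ha h)
      · exact Finset.disjoint_left.1 C.QW hv (C.A_sub_W j h)
    rw [C.cut_u_sep _ hsep, sum_chi_in _ _ _ hr, sum_chi_out _ _ _ hq, z1, z2]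
    simp
  have e2 : ∀ i, cutL (C.T i) C.u = 2 * t := by
    intro i
    have hrT : C.r ∉ C.T i := fun h => C.rW (C.TW i h)
    have hqT : C.q ∉ C.T i := fun h => C.qW (C.TW i h)
    have dz : ∀ X, Disjoint X C.W → X ∩ C.T i = ∅ := fun X hX =>
      disjoint_iff_inter_eq_empty.1 (hX.mono_right (C.TW i))
    rw [cut_u_nonsep _ _ (by tauto), sum_chi_out _ _ _ hrT, sum_chi_out _ _ _ hrT,
        sum_chi_out _ _ _ hrT, sum_chi_out _ _ _ hqT, sum_chi_out _ _ _ hqT,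
        sum_chi_out _ _ _ hqT, dz _ C.RW, dz _ C.QW, dz _ C.WF.symm,
        inter_eq_right.2 (C.TW i), C.cT]
    simp; ring
  have e3 : ∀ i, cutL (C.T i) (C.w b) = 0 := fun i => C.cut_w_zero b _ hb (C.TW i)
  have e4 : b ∩ C.H a = a ∩ b := by
    ext v
    rw [mem_inter, mem_H, mem_inter]
    constructor
    · rintro ⟨hv, rfl | h | h | ⟨j, h⟩⟩
      · exact absurd (hb hv) C.rF
      · exact absurd (hb hv) (Finset.disjoint_left.1 C.RF h)
      · exact ⟨h, hv⟩
      · exact absurd (hb hv) (Finset.disjoint_left.1 C.WF (C.A_sub_W j h))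
    · rintro ⟨h1, h2⟩
      exact ⟨h2, Or.inr (Or.inr (Or.inl h1))⟩
  simp only [g, p, LinearMap.add_apply, LinearMap.sum_apply, map_add, map_smul, smul_eq_mul,
    e1, e2, e3, C.cut_w_sep b _ hsep, sum_chi_out _ _ _ hq, e4]
  simp only [sum_const_zero, add_zero]
  simp
  right
  ring

end Cfg

/-- Intervals of `Fin n`. -/
noncomputable def iv (n a b : ℕ) : Finset (Fin n) := univ.filter fun v => a ≤ v.1 ∧ v.1 < b

lemma mem_iv {n a b : ℕ} (v : Fin n) : v ∈ iv n a b ↔ a ≤ v.1 ∧ v.1 < b := by simp [iv]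

lemma card_iv {n a b : ℕ} (hb : b ≤ n) : (iv n a b).card = b - a := by
  rw [← Nat.card_Ico, ← card_map Fin.valEmbedding]
  congr 1
  ext x
  simp only [mem_map, mem_iv, Fin.valEmbedding_apply, mem_Ico]
  constructor
  · rintro ⟨v, hv, rfl⟩; exact hv
  · intro hx; exact ⟨⟨x, by omega⟩, hx, rfl⟩

/-- The concrete configuration. -/
noncomputable def theCfg (n h t : ℕ) (hht : h ≤ t) (hn : 5 * t + 2 ≤ n) : Cfg n h t where
  r := ⟨0, by omega⟩
  q := ⟨1, by omega⟩
  R := iv n 2 (2 + t)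
  Q := iv n (2 + t) (2 + 2 * t)
  W := iv n (2 + 2 * t) (2 + 5 * t)
  F := iv n (2 + 5 * t) n
  T i := iv n (2 + 2 * t + i.1 * t) (2 + 3 * t + i.1 * t)
  A i := iv n (2 + 2 * t + i.1 * t) (2 + 2 * t + h + i.1 * t)
  rq := by simp
  rR := by simp [mem_iv]
  rQ := by simp [mem_iv]
  rW := by simp [mem_iv]
  rF := by simp [mem_iv]
  qR := by simp [mem_iv]
  qQ := by simp [mem_iv]; omega
  qW := by simp [mem_iv]; omega
  qF := by simp [mem_iv]; omega
  RQ := by rw [Finset.disjoint_left]; intro v; simp only [mem_iv]; omega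
  RW := by rw [Finset.disjoint_left]; intro v; simp only [mem_iv]; omega
  RF := by rw [Finset.disjoint_left]; intro v; simp only [mem_iv]; omega
  QW := by rw [Finset.disjoint_left]; intro v; simp only [mem_iv]; omega
  QF := by rw [Finset.disjoint_left]; intro v; simp only [mem_iv]; omega
  WF := by rw [Finset.disjoint_left]; intro v; simp only [mem_iv]; omega
  cover v := by
    have := v.2
    simp only [mem_iv, Fin.ext_iff]; omega
  cR := by rw [card_iv] <;> omega
  cQ := by rw [card_iv] <;> omega
  cW := by rw [card_iv] <;> omega
  TW i := by
    intro v; simp only [mem_iv]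
    fin_cases i <;> simp <;> omega
  TT i j hij := by
    rw [Finset.disjoint_left]; intro v; simp only [mem_iv]
    fin_cases i <;> fin_cases j <;> simp at hij ⊢ <;> omega
  cT i := by
    rw [card_iv]
    · omega
    · fin_cases i <;> simp <;> omega
  AT i := by
    intro v; simp only [mem_iv]
    omega
  cA i := by
    rw [card_iv]
    · omega
    · fin_cases i <;> simp <;> omega

/-- The polyhedron is a polyhedron: finitely many comb inequalities suffice. -/
lemma ext_exists (h t n : ℕ) (ht : 1 ≤ t) : ∃ k : ℕ, ∃ (m : ℕ) (A : Matrix (Fin k) (Fin m) ℝ)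
    (b : Fin k → ℝ) (π : (Fin m → ℝ) →ₗ[ℝ] (KEdge n → ℝ)),
      π '' {x | A.mulVec x ≤ b} = uniformCombPolytope h t n := by
  let I := {c : Finset (Fin n) × (Σ k : Fin (n + 1), Fin k.1 → Finset (Fin n)) //
    IsUniformComb h t c.1 c.2.2}
  let eI := Fintype.equivFin I
  let eE := Fintype.equivFin (KEdge n)
  let G : I → (KEdge n → ℝ) →ₗ[ℝ] ℝ := fun c => cutL c.1.1 + ∑ i, cutL (c.1.2.2 i)
  let π : (Fin (Fintype.card (KEdge n)) → ℝ) ≃ₗ[ℝ] (KEdge n → ℝ) :=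
    LinearEquiv.funCongrLeft ℝ ℝ eE
  let M : (Fin (Fintype.card (KEdge n)) → ℝ) →ₗ[ℝ] (Fin (Fintype.card I) → ℝ) :=
    LinearMap.pi fun j => -(G (eI.symm j) ∘ₗ π.toLinearMap)
  refine ⟨Fintype.card I, Fintype.card (KEdge n), LinearMap.toMatrix' M,
    fun j => -(3 * ((eI.symm j).1.2.1 : ℕ) + 1 : ℝ), π.toLinearMap, ?_⟩
  have hmem : ∀ y, (LinearMap.toMatrix' M).mulVec y ≤
      (fun j => -(3 * ((eI.symm j).1.2.1 : ℕ) + 1 : ℝ)) ↔ π y ∈ uniformCombPolytope h t n := by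
    intro y
    have e0 : (LinearMap.toMatrix' M).mulVec y = M y := by
      rw [← Matrix.toLin'_apply, Matrix.toLin'_toMatrix']
    rw [e0]
    have e1 : ∀ j, M y j = -(cutSum (eI.symm j).1.1 (π y)
        + ∑ i, cutSum ((eI.symm j).1.2.2 i) (π y)) := by
      intro j
      simp [M, G, cutL_apply]
    constructor
    · intro hle H k T hT
      have hk : k ≤ n := Cfg.teeth_le ht hT.1.2.2.1 fun i => (hT.2 i).1
      have hall : ∀ c : I, (3 * (c.1.2.1 : ℕ) + 1 : ℝ) ≤
          cutSum c.1.1 (π y) + ∑ i, cutSum (c.1.2.2 i) (π y) := by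
        intro c
        obtain ⟨j, rfl⟩ := eI.symm.surjective c
        have := hle j
        rw [e1] at this
        simp only at this
        linarith
      exact hall ⟨(H, ⟨⟨k, by omega⟩, T⟩), hT⟩
    · intro hy j
      rw [e1]
      have := hy _ _ _ (eI.symm j).2
      simp only
      linarith
  ext x
  constructor
  · rintro ⟨y, hy, rfl⟩
    exact (hmem y).1 hy
  · intro hx
    refine ⟨π.symm x, ?_, by simp⟩
    exact (hmem _).2 (by simpa using hx)

theorem uniform_comb_polytope_xc_exponential (h t : ℕ) (hh : 1 ≤ h) (hht : h < t) :
    ∃ c : ℝ, 0 < c ∧ ∃ N : ℕ, ∀ n : ℕ, t ∣ n → N ≤ n →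
      (2 : ℝ) ^ (c * n / t) ≤ (xc (uniformCombPolytope h t n) : ℝ) := by
  have ht : (0 : ℝ) < t := by exact_mod_cast (by omega : 0 < t)
  refine ⟨t / 8, by positivity, 10 * t + 8, fun n _ hn => ?_⟩
  have hmem := Nat.sInf_mem (ext_exists h t n (by omega))
  change xc (uniformCombPolytope h t n) ∈ _ at hmem
  set k := xc (uniformCombPolytope h t n) with hk
  obtain ⟨m, A, b, π, hπ⟩ := hmem
  let C := theCfg n h t hht.le (by omega)
  have hF : C.F.card = n - (2 + 5 * t) := card_iv le_rfl
  have key := ext_bound C.F (uniformCombPolytope h t n) C.g 10 C.p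
    (by
      intro a ha x hx
      have := hx _ _ _ (C.H_comb hh a ha)
      simp only [Cfg.g, LinearMap.add_apply, LinearMap.sum_apply, cutL_apply]
      norm_num at this ⊢
      exact this)
    (fun b hb => C.p_mem (by omega) b hb) (fun a ha b hb => by convert C.slack a b ha hb)
    k m A b π hπ
  rw [hF] at key
  set f := n - (2 + 5 * t) with hf
  have hfn : n ≤ 2 * f := by omega
  have key' : (3 / 2 : ℝ) ^ f ≤ k + 1 := by
    rw [div_pow, div_le_iff₀ (by positivity)]
    exact_mod_cast key
  have hexp : (t / 8 : ℝ) * n / t = n / 8 := by field_simp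
  rw [hexp]
  set X := (2 : ℝ) ^ ((n : ℝ) / 8) with hX
  have hX2 : 2 ≤ X := by
    have : (2 : ℝ) ^ (1 : ℝ) ≤ X := by
      apply Real.rpow_le_rpow_of_exponent_le (by norm_num)
      have : (8 : ℝ) ≤ n := by exact_mod_cast (by omega : 8 ≤ n)
      linarith
    simpa using this
  have hX8 : X ^ 8 = 2 ^ n := by
    rw [hX, ← Real.rpow_natCast, ← Real.rpow_mul (by norm_num), ← Real.rpow_natCast]
    congr 1; push_cast; ring
  have hXX : X ^ 2 ≤ (3 / 2 : ℝ) ^ f := by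
    refine le_of_pow_le_pow_left₀ (n := 4) (by norm_num) (by positivity) ?_
    calc (X ^ 2) ^ 4 = 2 ^ n := by rw [← hX8]; ring
      _ ≤ 2 ^ (2 * f) := pow_le_pow_right₀ (by norm_num) hfn
      _ = 4 ^ f := by rw [pow_mul]; norm_num
      _ ≤ ((3 / 2) ^ 4) ^ f := pow_le_pow_left₀ (by norm_num) (by norm_num) f
      _ = ((3 / 2) ^ f) ^ 4 := by rw [← pow_mul, ← pow_mul, mul_comm]
  nlinarith
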